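/- For any linear pentapod design with planar base there exist real constants c_1,…,c_9 (depending only on the design parameters) such that for every pose (u,v,w,p_x,p_y,p_z) ∈ ℝ⁶: det S = w²(c_1 p_x + c_2 p_y) + p_z²(c_3 u + c_4 v) + w p_z (c_5 + c_6 u + c_7 v + c_8 p_x + c_9 p_y). In particular, every monomial of det S is divisible by w², w p_z, or p_z². -/

import Mathlib

open Matrix

/-- The 7×7 matrix `S` of a linear pentapod design with platform parameters
`r` and base coordinates `x`, `y`, `z` (indices `1,…,4` of `Fin 5` correspond to
legs `2,…,5`; index `0` corresponds to leg `1`), at pose `(u,v,w,px,py,pz)`. -/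
noncomputable def Smat (r x y z : Fin 5 → ℝ) (u v w px py pz : ℝ) :
    Matrix (Fin 7) (Fin 7) ℝ :=
  !![(1 : ℝ), u, v, w, px, py, pz;
     0, px, py, pz, 0, 0, 0;
     0, 0, 0, 0, u, v, w;
     r 1, x 1, y 1, z 1, r 1 * x 1, r 1 * y 1, r 1 * z 1;
     r 2, x 2, y 2, z 2, r 2 * x 2, r 2 * y 2, r 2 * z 2;
     r 3, x 3, y 3, z 3, r 3 * x 3, r 3 * y 3, r 3 * z 3;
     r 4, x 4, y 4, z 4, r 4 * x 4, r 4 * y 4, r 4 * z 4]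

/-- The 4×7 architecture matrix of the design. -/
noncomputable def archMat (r x y z : Fin 5 → ℝ) : Matrix (Fin 4) (Fin 7) ℝ :=
  !![r 1, x 1, y 1, z 1, r 1 * x 1, r 1 * y 1, r 1 * z 1;
     r 2, x 2, y 2, z 2, r 2 * x 2, r 2 * y 2, r 2 * z 2;
     r 3, x 3, y 3, z 3, r 3 * x 3, r 3 * y 3, r 3 * z 3;
     r 4, x 4, y 4, z 4, r 4 * x 4, r 4 * y 4, r 4 * z 4]

/-- The design is architecturally singular: the singularity polynomial `det S`
vanishes at every pose on the quadric `u² + v² + w² = 1`. -/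
def ArchSingular (r x y z : Fin 5 → ℝ) : Prop :=
  ∀ u v w px py pz : ℝ, u ^ 2 + v ^ 2 + w ^ 2 = 1 →
    (Smat r x y z u v w px py pz).det = 0

/-- The bracket `[A₁, A₂, A₃, A₄]`: the determinant of the 4×4 matrix with
columns `A₁, A₂, A₃, A₄`. -/
noncomputable def bracket (A1 A2 A3 A4 : Fin 4 → ℝ) : ℝ :=
  (Matrix.of fun i j => ![A1, A2, A3, A4] j i).det

/-- The vector in `ℝ⁴` formed by the values of `f` at legs `2,…,5`. -/
def colVec (f : Fin 5 → ℝ) : Fin 4 → ℝ := fun i => f i.succ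

/-- The componentwise product vector (e.g. `rX`, `rY`, `rZ`) for legs `2,…,5`. -/
def colProd (r f : Fin 5 → ℝ) : Fin 4 → ℝ := fun i => r i.succ * f i.succ

/-- The base anchor point `M_j = (x_j, y_j, z_j) ∈ ℝ³`. -/
def Mpt (x y z : Fin 5 → ℝ) (j : Fin 5) : Fin 3 → ℝ := ![x j, y j, z j]

/-- The `4×5` matrix of the columns `r, x, y, rx, ry` for legs `2,…,5`, i.e. the columns of the
architecture matrix that survive for a planar base. -/
noncomputable def planarArchMat (r x y : Fin 5 → ℝ) : Matrix (Fin 4) (Fin 5) ℝ :=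
  of fun i => ![r i.succ, x i.succ, y i.succ, r i.succ * x i.succ, r i.succ * y i.succ]

/-- The maximal minor of `planarArchMat` that omits column `k`. -/
noncomputable def planarMinor (r x y : Fin 5 → ℝ) (k : Fin 5) : ℝ :=
  ((planarArchMat r x y).submatrix id k.succAbove).det

theorem det_cons_planarArchMat (r x y : Fin 5 → ℝ) (a : Fin 5 → ℝ) :
    (of (vecCons a (planarArchMat r x y))).det =
      a 0 * planarMinor r x y 0 - a 1 * planarMinor r x y 1 + a 2 * planarMinor r x y 2 -
        a 3 * planarMinor r x y 3 + a 4 * planarMinor r x y 4 := by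
  have h (k : Fin 5) : (of (vecCons a (planarArchMat r x y))).submatrix Fin.succ k.succAbove =
      (planarArchMat r x y).submatrix id k.succAbove := rfl
  rw [det_succ_row_zero]
  have h0 (k : Fin 5) : of (vecCons a (planarArchMat r x y)) 0 k = a k := rfl
  simp only [h, h0, Fin.sum_univ_five, planarMinor]
  norm_num
  ring

/-- Laplace expansion of `det S` along the columns `z` and `rz` for a planar base. -/
theorem det_Smat_of_planar (r x y z : Fin 5 → ℝ) (hz : ∀ j, z j = 0) (u v w px py pz : ℝ) :
    (Smat r x y z u v w px py pz).det =
      -(w ^ 2 * (of (vecCons ![0, px, py, 0, 0] (planarArchMat r x y))).det) -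
        pz ^ 2 * (of (vecCons ![0, 0, 0, u, v] (planarArchMat r x y))).det +
        w * pz * (of (vecCons ![1, u, v, px, py] (planarArchMat r x y))).det := by
  set S := Smat r x y z u v w px py pz with hS
  have hcol : S.det = pz * (S.submatrix (Fin.succAbove 0) (Fin.succAbove 6)).det +
      w * (S.submatrix (Fin.succAbove 2) (Fin.succAbove 6)).det := by
    rw [det_succ_column S 6]
    simp [Fin.sum_univ_succ, hS, Smat, hz]
    norm_num [Fin.ext_iff]
  have h0 : (S.submatrix (Fin.succAbove 0) (Fin.succAbove 6)).det =
      -(pz * (of (vecCons ![0, 0, 0, u, v] (planarArchMat r x y))).det) := by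
    have e : (S.submatrix (Fin.succAbove 0) (Fin.succAbove 6)).submatrix
        (Fin.succAbove 0) (Fin.succAbove 3) =
        of (vecCons ![0, 0, 0, u, v] (planarArchMat r x y)) := by
      ext i j; fin_cases i <;> fin_cases j <;> rfl
    rw [det_succ_column _ 3, Fin.sum_univ_succ, e]
    simp [Fin.sum_univ_succ, hS, Smat, hz, Fin.succAbove]
    norm_num [Fin.ext_iff]
  have h2 : (S.submatrix (Fin.succAbove 2) (Fin.succAbove 6)).det =
      -(w * (of (vecCons ![0, px, py, 0, 0] (planarArchMat r x y))).det) +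
        pz * (of (vecCons ![1, u, v, px, py] (planarArchMat r x y))).det := by
    have e0 : (S.submatrix (Fin.succAbove 2) (Fin.succAbove 6)).submatrix
        (Fin.succAbove 0) (Fin.succAbove 3) =
        of (vecCons ![0, px, py, 0, 0] (planarArchMat r x y)) := by
      ext i j; fin_cases i <;> fin_cases j <;> rfl
    have e1 : (S.submatrix (Fin.succAbove 2) (Fin.succAbove 6)).submatrix
        (Fin.succAbove (Fin.succ 0)) (Fin.succAbove 3) =
        of (vecCons ![1, u, v, px, py] (planarArchMat r x y)) := by
      ext i j; fin_cases i <;> fin_cases j <;> rfl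
    rw [det_succ_column _ 3, Fin.sum_univ_succ, Fin.sum_univ_succ, e0, e1]
    simp [Fin.sum_univ_succ, hS, Smat, hz, Fin.succAbove]
    norm_num [Fin.ext_iff]
  rw [hcol, h0, h2]
  ring

theorem stmt12 (r x y z : Fin 5 → ℝ)
    (hr1 : r 0 = 0) (hx1 : x 0 = 0) (hy1 : y 0 = 0) (hz1 : z 0 = 0)
    (hplanar : ∀ j, z j = 0) :
    ∃ c1 c2 c3 c4 c5 c6 c7 c8 c9 : ℝ, ∀ u v w px py pz : ℝ,
      (Smat r x y z u v w px py pz).det =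
        w ^ 2 * (c1 * px + c2 * py) + pz ^ 2 * (c3 * u + c4 * v) +
          w * pz * (c5 + c6 * u + c7 * v + c8 * px + c9 * py) := by
  refine ⟨planarMinor r x y 1, -planarMinor r x y 2, planarMinor r x y 3, -planarMinor r x y 4,
    planarMinor r x y 0, -planarMinor r x y 1, planarMinor r x y 2, -planarMinor r x y 3,
    planarMinor r x y 4, fun u v w px py pz => ?_⟩
  rw [det_Smat_of_planar r x y z hplanar]
  simp only [det_cons_planarArchMat]
  simp
  ring
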